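/- arXiv:math/0405001 — 10 statements merged into one kernel-verified Lean document; each statement's English description precedes it below -/
import Mathlib

section
/- For every integer r ≥ 2 and every real number p with 0 < p < r, there exists N such that for all n ≥ N, φ(r,p,n) = f(p, T_r(n)); that is, for all sufficiently large n the maximum of the sum of p-th degree powers over K_{r+1}-free graphs on n vertices is attained by the Turán graph T_r(n). -/
open Finset

/-- `f(p,G)`: the sum of the `p`-th powers of the vertex degrees of `G`. -/
noncomputable def degPowerSum (p : ℝ) {V : Type*} [Fintype V] (G : SimpleGraph V) : ℝ :=
  letI := Classical.decRel G.Adj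
  ∑ u, (G.degree u : ℝ) ^ p

/-- `φ(r,p,n)`: the maximum of `f(p,G)` over `K_{r+1}`-free graphs on `n` vertices. -/
noncomputable def phiClique (r : ℕ) (p : ℝ) (n : ℕ) : ℝ :=
  sSup {x | ∃ G : SimpleGraph (Fin n), G.CliqueFree (r + 1) ∧ x = degPowerSum p G}

/-- Erdős's degree majorization, relative to a finite vertex set `S`: if `G` is `K_{r+1}`-free on
`S`, then `S` can be coloured with `r` colours so that no vertex has more neighbours in `S` than
there are vertices of `S` outside its colour class. -/
theorem SimpleGraph.exists_coloring_degree_majorization {V : Type*} [DecidableEq V]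
    (G : SimpleGraph V) [DecidableRel G.Adj] (r : ℕ) (S : Finset V)
    (h : G.CliqueFreeOn S (r + 1)) :
    ∃ c : V → ℕ, (∀ v ∈ S, c v < r) ∧
      ∀ v ∈ S, #{u ∈ S | G.Adj v u} + #{u ∈ S | c u = c v} ≤ #S := by
  induction r generalizing S with
  | zero =>
    refine ⟨fun _ => 0, ?_, ?_⟩ <;>
    · intro v hv
      exact absurd (G.isNClique_singleton.2 rfl) (h (t := {v}) (by simpa using hv))
  | succ r ih =>
    rcases S.eq_empty_or_nonempty with rfl | hS
    · exact ⟨fun _ => 0, by simp, by simp⟩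
    obtain ⟨v, hv, hmax⟩ := S.exists_max_image (fun v => #{u ∈ S | G.Adj v u}) hS
    set T := {u ∈ S | G.Adj v u} with hT
    have hTS : T ⊆ S := filter_subset _ _
    have hcard : #(S \ T) + #T = #S := card_sdiff_add_card_eq_card hTS
    obtain ⟨c, hc, hd⟩ := ih T (by
      refine SimpleGraph.CliqueFreeOn.subset _ (fun u hu => ?_)
        (SimpleGraph.CliqueFreeOn.of_succ _ h hv)
      simpa [hT] using hu)
    refine ⟨fun u => if u ∈ T then c u else r, fun u _ => ?_, fun u hu => ?_⟩
    · dsimp only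
      split_ifs with huT
      · exact (hc u huT).trans (Nat.lt_succ_self r)
      · exact Nat.lt_succ_self r
    dsimp only
    by_cases huT : u ∈ T
    · have h₁ : {w ∈ S | (if w ∈ T then c w else r) = if u ∈ T then c u else r} ⊆
          {w ∈ T | c w = c u} := by
        intro w hw
        simp only [mem_filter, huT, if_true] at hw ⊢
        have := hc u huT
        by_cases hwT : w ∈ T
        · exact ⟨hwT, by simpa [hwT] using hw.2⟩
        · have := hw.2
          rw [if_neg hwT] at this
          omega
      have h₂ : {w ∈ S | G.Adj u w} ⊆ {w ∈ T | G.Adj u w} ∪ (S \ T) := by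
        intro w hw
        simp only [mem_filter, mem_union, mem_sdiff] at hw ⊢
        tauto
      have h₃ := (card_le_card h₂).trans (card_union_le _ _)
      have h₄ := card_le_card h₁
      have h₅ := hd u huT
      omega
    · have h₁ : {w ∈ S | (if w ∈ T then c w else r) = if u ∈ T then c u else r} ⊆ S \ T := by
        intro w hw
        simp only [mem_filter, huT, if_false] at hw
        refine mem_sdiff.2 ⟨hw.1, fun hwT => ?_⟩
        have := hc w hwT
        rw [if_pos hwT] at hw
        omega
      have h₂ := hmax u hu
      have h₃ := card_le_card h₁
      omega

/-- The contribution to the degree power sum of a class of size `x` in a complete multipartite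
graph on `n` vertices. -/
noncomputable def classWeight (p n x : ℝ) : ℝ := x * (n - x) ^ p

theorem continuous_classWeight {p : ℝ} (hp : 0 < p) (n : ℝ) : Continuous (classWeight p n) := by
  unfold classWeight
  exact continuous_id.mul ((continuous_const.sub continuous_id).rpow_const fun _ => Or.inr hp.le)

theorem hasDerivAt_classWeight {p n x : ℝ} (hx : x < n) :
    HasDerivAt (classWeight p n) ((n - x) ^ (p - 1) * (n - (p + 1) * x)) x := by
  have h₀ : n - x ≠ 0 := (sub_pos.2 hx).ne'
  have h₁ : HasDerivAt (fun y => n - y) (-1) x := by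
    simpa using (hasDerivAt_id x).const_sub n
  refine ((hasDerivAt_id x).mul (h₁.rpow_const (p := p) (Or.inl h₀))).congr_deriv ?_
  have : (n - x) ^ p = (n - x) ^ (p - 1) * (n - x) := by
    rw [← Real.rpow_add_one h₀, sub_add_cancel]
  simp only [id, this]
  ring

theorem hasDerivAt_deriv_classWeight {p n x : ℝ} (hx : x < n) :
    HasDerivAt (fun x => (n - x) ^ (p - 1) * (n - (p + 1) * x))
      ((n - x) ^ (p - 2) * (p * ((p + 1) * x - 2 * n))) x := by
  have h₀ : n - x ≠ 0 := (sub_pos.2 hx).ne'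
  have h₁ : HasDerivAt (fun y => n - y) (-1) x := by
    simpa using (hasDerivAt_id x).const_sub n
  have h₂ : HasDerivAt (fun y => n - (p + 1) * y) (-(p + 1)) x := by
    simpa using ((hasDerivAt_id x).const_mul (p + 1)).const_sub n
  refine ((h₁.rpow_const (p := p - 1) (Or.inl h₀)).mul h₂).congr_deriv ?_
  have h₃ : (n - x) ^ (p - 1) = (n - x) ^ (p - 2) * (n - x) := by
    rw [← Real.rpow_add_one h₀]
    congr 1
    ring
  have h₄ : p - 1 - 1 = p - 2 := by ring
  rw [h₄, h₃]
  ring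

theorem concaveOn_classWeight {p : ℝ} (hp : 0 < p) (n : ℝ) :
    ConcaveOn ℝ (Set.Icc 0 (min n (2 * n / (p + 1)))) (classWeight p n) := by
  have key : ∀ x ∈ interior (Set.Icc 0 (min n (2 * n / (p + 1)))),
      x < n ∧ (p + 1) * x ≤ 2 * n := by
    intro x hx
    rw [interior_Icc, Set.mem_Ioo, lt_min_iff, lt_div_iff₀ (by positivity)] at hx
    exact ⟨hx.2.1, by linarith [hx.2.2]⟩
  refine concaveOn_of_hasDerivWithinAt2_nonpos (convex_Icc _ _)
    (continuous_classWeight hp n).continuousOn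
    (fun x hx => (hasDerivAt_classWeight (key x hx).1).hasDerivWithinAt)
    (fun x hx => (hasDerivAt_deriv_classWeight (key x hx).1).hasDerivWithinAt) fun x hx => ?_
  exact mul_nonpos_of_nonneg_of_nonpos (Real.rpow_nonneg (by linarith [(key x hx).1]) _)
    (mul_nonpos_of_nonneg_of_nonpos hp.le (by linarith [(key x hx).2]))

theorem monotoneOn_classWeight {p n : ℝ} (hp : 0 < p) :
    MonotoneOn (classWeight p n) (Set.Icc 0 (n / (p + 1))) := by
  have key : ∀ x ∈ interior (Set.Icc 0 (n / (p + 1))), x < n ∧ (p + 1) * x ≤ n := by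
    intro x hx
    rw [interior_Icc, Set.mem_Ioo, lt_div_iff₀ (by positivity)] at hx
    exact ⟨by nlinarith, by linarith⟩
  refine monotoneOn_of_hasDerivWithinAt_nonneg (convex_Icc _ _)
    (continuous_classWeight hp n).continuousOn
    (fun x hx => (hasDerivAt_classWeight (key x hx).1).hasDerivWithinAt) fun x hx => ?_
  exact mul_nonneg (Real.rpow_nonneg (by linarith [(key x hx).1]) _) (by linarith [(key x hx).2])

theorem antitoneOn_classWeight {p : ℝ} (hp : 0 < p) (n : ℝ) :
    AntitoneOn (classWeight p n) (Set.Icc (n / (p + 1)) n) := by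
  have key : ∀ x ∈ interior (Set.Icc (n / (p + 1)) n), x < n ∧ n ≤ (p + 1) * x := by
    intro x hx
    rw [interior_Icc, Set.mem_Ioo, div_lt_iff₀ (by positivity)] at hx
    exact ⟨hx.2, by linarith⟩
  refine antitoneOn_of_hasDerivWithinAt_nonpos (convex_Icc _ _)
    (continuous_classWeight hp n).continuousOn
    (fun x hx => (hasDerivAt_classWeight (key x hx).1).hasDerivWithinAt) fun x hx => ?_
  exact mul_nonpos_of_nonneg_of_nonpos (Real.rpow_nonneg (by linarith [(key x hx).1]) _)
    (by linarith [(key x hx).2])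

theorem ConcaveOn.add_le_add_of_move {s : Set ℝ} {f : ℝ → ℝ} (hf : ConcaveOn ℝ s f) {a b : ℝ}
    (ha : a ∈ s) (hb : b ∈ s) (hab : b + 1 ≤ a) : f a + f b ≤ f (a - 1) + f (b + 1) := by
  have hd : 0 < a - b := by linarith
  have ht : 0 ≤ 1 / (a - b) := by positivity
  have ht' : 0 ≤ 1 - 1 / (a - b) := by
    rw [sub_nonneg, div_le_one hd]
    linarith
  have h₁ := hf.2 ha hb ht' ht (by ring)
  have h₂ := hf.2 ha hb ht ht' (by ring)
  have e₁ : (1 - 1 / (a - b)) • a + (1 / (a - b)) • b = a - 1 := by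
    simp only [smul_eq_mul]
    field_simp
    ring
  have e₂ : (1 / (a - b)) • a + (1 - 1 / (a - b)) • b = b + 1 := by
    simp only [smul_eq_mul]
    field_simp
    ring
  rw [e₁] at h₁
  rw [e₂] at h₂
  simp only [smul_eq_mul] at h₁ h₂
  linarith

/-- Moving one vertex from a class of size `a` to a class of size `b` does not decrease the total
weight, provided that `r - 1` classes of size at least `b` fit next to the class of size `a`. -/
theorem classWeight_move {r p n a b : ℝ} (hp : 0 < p) (hr : 1 ≤ r) (hn : p + 1 ≤ n)
    (hlarge : (r - 1) * (p + 1) ≤ n * (r - p)) (hb : 0 ≤ b) (hab : b + 2 ≤ a)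
    (hsum : a + (r - 1) * b ≤ n) :
    classWeight p n a + classWeight p n b ≤
      classWeight p n (a - 1) + classWeight p n (b + 1) := by
  have hp1 : 0 < p + 1 := by linarith
  have han : a ≤ n := by nlinarith
  by_cases hmid : b + 1 ≤ n / (p + 1) ∧ n / (p + 1) ≤ a - 1
  · have h₁ := antitoneOn_classWeight hp n (a := a - 1) (b := a) ⟨hmid.2, by linarith⟩
      ⟨by linarith, han⟩ (by linarith)
    have h₂ := monotoneOn_classWeight hp (a := b) (b := b + 1)
      ⟨hb, by linarith⟩ ⟨by linarith, hmid.1⟩ (by linarith)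
    linarith
  · have ha2 : a ≤ 2 * n / (p + 1) := by
      rw [le_div_iff₀ hp1]
      rw [not_and_or, not_le, not_le, div_lt_iff₀ hp1, lt_div_iff₀ hp1] at hmid
      rcases hmid with hmid | hmid <;> nlinarith
    exact (concaveOn_classWeight hp n).add_le_add_of_move ⟨by linarith, le_min han ha2⟩
      ⟨hb, le_min (by linarith) (by linarith)⟩ (by linarith)

theorem sum_range_move {r : ℕ} (m : ℕ → ℕ) {i j : ℕ} (hi : i ∈ range r) (hj : j ∈ range r)
    (hij : i ≠ j) (x y : ℕ) (F : ℕ → ℝ) :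
    ∑ k ∈ range r, F (if k = i then x else if k = j then y else m k) =
      ∑ k ∈ range r, F (m k) + (F x - F (m i)) + (F y - F (m j)) := by
  have h : ∀ k, F (if k = i then x else if k = j then y else m k) =
      F (m k) + (if k = i then F x - F (m i) else 0) + (if k = j then F y - F (m j) else 0) := by
    intro k
    by_cases h₁ : k = i
    · subst h₁
      simp [hij]
    · by_cases h₂ : k = j
      · subst h₂
        simp [h₁]
      · simp [h₁, h₂]
  simp only [h, sum_add_distrib, sum_ite_eq', hi, hj, if_true]

theorem sum_eq_of_balanced {r n q : ℕ} (m : ℕ → ℕ)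
    (hm : ∑ i ∈ range r, m i = n) (hlo : ∀ i ∈ range r, q ≤ m i)
    (hhi : ∀ i ∈ range r, m i ≤ q + 1) (hlt : ∃ i ∈ range r, m i = q) (F : ℕ → ℝ) :
    ∑ i ∈ range r, F (m i) =
      r * F (n / r) + (n - r * (n / r : ℕ)) * (F (n / r + 1) - F (n / r)) := by
  have hq : n / r = q := by
    obtain ⟨i, hi, hiq⟩ := hlt
    have h₁ : ∑ _i ∈ range r, q ≤ ∑ i ∈ range r, m i := sum_le_sum hlo
    have h₂ : ∑ i ∈ range r, m i < ∑ _i ∈ range r, (q + 1) :=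
      sum_lt_sum hhi ⟨i, hi, by omega⟩
    simp only [sum_const, card_range, smul_eq_mul, hm] at h₁ h₂
    refine Nat.div_eq_of_lt_le ?_ ?_
    · linarith [mul_comm q r]
    · linarith [mul_comm (q + 1) r]
  have hF : ∀ i ∈ range r, F (m i) = F q + ((m i : ℝ) - q) * (F (q + 1) - F q) := by
    intro i hi
    have := hlo i hi
    have := hhi i hi
    obtain h | h : m i = q ∨ m i = q + 1 := by omega
    · simp [h]
    · simp [h]
  rw [sum_congr rfl hF, sum_add_distrib, ← sum_mul, sum_sub_distrib, ← Nat.cast_sum, hm, hq]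
  simp

theorem sum_classWeight_le {r n : ℕ} {p : ℝ} (hr : 0 < r) (hp : 0 < p) (hn : p + 1 ≤ n)
    (hlarge : ((r : ℝ) - 1) * (p + 1) ≤ n * (r - p)) (m : ℕ → ℕ)
    (hm : ∑ i ∈ range r, m i = n) :
    ∑ i ∈ range r, classWeight p n (m i) ≤
      r * classWeight p n (n / r : ℕ) + (n - r * (n / r : ℕ)) *
        (classWeight p n (n / r + 1 : ℕ) - classWeight p n (n / r : ℕ)) := by
  induction hk : ∑ i ∈ range r, m i ^ 2 using Nat.strong_induction_on generalizing m with
  | _ k ih =>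
  have hne : (range r).Nonempty := nonempty_range_iff.2 hr.ne'
  obtain ⟨i, hi, hmax⟩ := (range r).exists_max_image m hne
  obtain ⟨j, hj, hmin⟩ := (range r).exists_min_image m hne
  by_cases hij : m i ≤ m j + 1
  · exact (sum_eq_of_balanced m hm hmin (fun l hl => (hmax l hl).trans hij) ⟨j, hj, rfl⟩
      (fun x => classWeight p n x)).le
  push Not at hij
  have hne' : i ≠ j := by
    rintro rfl
    omega
  have hcast : ((m i - 1 : ℕ) : ℝ) = m i - 1 := by
    rw [Nat.cast_sub (by omega), Nat.cast_one]
  have hij' : (m j : ℝ) + 2 ≤ m i := by exact_mod_cast hij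
  have hsum := sum_range_move m hi hj hne' (m i - 1) (m j + 1)
  have hW := hsum (fun x => classWeight p n x)
  have hS := hsum (fun x => (x : ℝ))
  have hQ := hsum (fun x => (x : ℝ) ^ 2)
  simp only [hcast, Nat.cast_add, Nat.cast_one] at hW hS hQ
  have hmove : (m i : ℝ) + (r - 1) * m j ≤ n := by
    have h₁ := add_sum_erase (range r) m hi
    have h₂ : #((range r).erase i) • m j ≤ ∑ l ∈ (range r).erase i, m l :=
      card_nsmul_le_sum _ _ _ fun l hl => hmin l (mem_of_mem_erase hl)
    rw [card_erase_of_mem hi, card_range, smul_eq_mul] at h₂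
    have h₃ : m i + (r - 1) * m j ≤ n := by omega
    have h₄ : ((m i + (r - 1) * m j : ℕ) : ℝ) ≤ n := by exact_mod_cast h₃
    rwa [Nat.cast_add, Nat.cast_mul, Nat.cast_sub hr, Nat.cast_one] at h₄
  have hstep := classWeight_move hp (by exact_mod_cast hr) hn hlarge (Nat.cast_nonneg (m j)) hij'
    hmove
  refine le_trans ?_ (ih _ ?_ (fun l => if l = i then m i - 1 else if l = j then m j + 1 else m l)
    ?_ rfl)
  · rw [hW]
    linarith
  · rw [← hk]
    have : ((∑ l ∈ range r, (if l = i then m i - 1 else if l = j then m j + 1 else m l) ^ 2 : ℕ)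
        : ℝ) < (∑ l ∈ range r, m l ^ 2 : ℕ) := by
      push_cast [-Nat.cast_ite]
      rw [hQ]
      nlinarith
    exact_mod_cast this
  · have : ((∑ l ∈ range r, (if l = i then m i - 1 else if l = j then m j + 1 else m l) : ℕ)
        : ℝ) = n := by
      rw [← hm]
      push_cast [-Nat.cast_ite]
      rw [hS]
      ring
    exact_mod_cast this

theorem sum_rpow_sub_card_class {n r : ℕ} (p : ℝ) (c : Fin n → ℕ) (hc : ∀ v, c v < r) :
    ∑ v, ((n : ℝ) - #{u | c u = c v}) ^ p =
      ∑ i ∈ range r, classWeight p n (#{u | c u = i} : ℕ) := by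
  rw [← sum_fiberwise_of_maps_to (s := univ) (t := range r) (g := c) (by simpa using hc)]
  refine sum_congr rfl fun i _ => ?_
  rw [sum_congr rfl (g := fun _ => ((n : ℝ) - #{u | c u = i}) ^ p), sum_const, nsmul_eq_mul,
    classWeight]
  intro v hv
  rw [(mem_filter.1 hv).2]

theorem sum_card_class {n r : ℕ} (c : Fin n → ℕ) (hc : ∀ v, c v < r) :
    ∑ i ∈ range r, #{u | c u = i} = n := by
  rw [← card_eq_sum_card_fiberwise (s := univ) (by simpa [Set.MapsTo] using hc), card_univ,
    Fintype.card_fin]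

theorem degPowerSum_le {n r : ℕ} {p : ℝ} (hr : 0 < r) (hp : 0 < p) (hn : p + 1 ≤ n)
    (hlarge : ((r : ℝ) - 1) * (p + 1) ≤ n * (r - p)) (G : SimpleGraph (Fin n))
    (hG : G.CliqueFree (r + 1)) :
    degPowerSum p G ≤ r * classWeight p n (n / r : ℕ) + (n - r * (n / r : ℕ)) *
        (classWeight p n (n / r + 1 : ℕ) - classWeight p n (n / r : ℕ)) := by
  classical
  obtain ⟨c, hc, hd⟩ := G.exists_coloring_degree_majorization r univ hG.cliqueFreeOn
  simp only [mem_univ, forall_const, card_univ, Fintype.card_fin] at hc hd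
  refine le_trans ?_ (sum_classWeight_le hr hp hn hlarge _ (sum_card_class c hc))
  rw [← sum_rpow_sub_card_class p c hc, degPowerSum]
  refine sum_le_sum fun v _ => Real.rpow_le_rpow (Nat.cast_nonneg _) ?_ hp.le
  have h₁ := hd v
  rw [← G.neighborFinset_eq_filter, G.card_neighborFinset_eq_degree] at h₁
  rw [le_sub_iff_add_le]
  exact_mod_cast (by convert h₁)

theorem degPowerSum_turanGraph {n r : ℕ} (p : ℝ) (hr : 0 < r) :
    degPowerSum p (SimpleGraph.turanGraph n r) =
      r * classWeight p n (n / r : ℕ) + (n - r * (n / r : ℕ)) *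
        (classWeight p n (n / r + 1 : ℕ) - classWeight p n (n / r : ℕ)) := by
  classical
  have hc : ∀ v : Fin n, (v : ℕ) % r < r := fun v => Nat.mod_lt _ hr
  have hcard : ∀ i ∈ range r,
      #{u : Fin n | (u : ℕ) % r = i} = n / r + if i < n % r then 1 else 0 := by
    intro i hi
    have hi' := Nat.mod_eq_of_lt (mem_range.1 hi)
    have h₁ := Nat.count_modEq_card n hr i
    rw [hi', Nat.count_eq_card_filter_range] at h₁
    rw [← h₁]
    refine card_bij (fun u _ => (u : ℕ)) (fun u hu => ?_) (fun _ _ _ _ => Fin.ext)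
      fun k hk => ?_
    · simpa [Nat.ModEq, hi'] using hu
    · rw [mem_filter, mem_range, Nat.ModEq, hi'] at hk
      exact ⟨⟨k, hk.1⟩, by simpa using hk.2, rfl⟩
  have hbal := sum_eq_of_balanced (q := n / r) (fun i => #{u : Fin n | (u : ℕ) % r = i})
    (sum_card_class _ hc) (fun i hi => by rw [hcard i hi]; omega)
    (fun i hi => by rw [hcard i hi]; split_ifs <;> omega)
    ⟨r - 1, by simp [hr], by
      have := Nat.mod_lt n hr
      rw [hcard _ (by simp [hr]), if_neg (by omega), add_zero]⟩
    (fun x => classWeight p n x)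
  rw [← hbal, ← sum_rpow_sub_card_class p _ hc, degPowerSum]
  refine sum_congr rfl fun v _ => ?_
  congr 1
  rw [eq_sub_iff_add_eq]
  have h₁ := card_filter_add_card_filter_not (s := (univ : Finset (Fin n)))
    (fun u => (u : ℕ) % r = (v : ℕ) % r)
  rw [card_univ, Fintype.card_fin, add_comm] at h₁
  rw [← SimpleGraph.card_neighborFinset_eq_degree, SimpleGraph.neighborFinset_eq_filter]
  norm_cast
  convert h₁ using 4
  simp [SimpleGraph.turanGraph_adj, eq_comm]

theorem stmt0 (r : ℕ) (hr : 2 ≤ r) (p : ℝ) (hp : 0 < p) (hpr : p < r) :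
    ∃ N : ℕ, ∀ n : ℕ, N ≤ n →
      phiClique r p n = degPowerSum p (SimpleGraph.turanGraph n r) := by
  have hr0 : 0 < r := by omega
  have hrp : 0 < (r : ℝ) - p := sub_pos.2 hpr
  obtain ⟨N, hN⟩ := exists_nat_ge (max (p + 1) (((r : ℝ) - 1) * (p + 1) / (r - p)))
  refine ⟨N, fun n hNn => ?_⟩
  have hn := hN.trans (Nat.cast_le.2 hNn)
  rw [max_le_iff, div_le_iff₀ hrp] at hn
  refine IsGreatest.csSup_eq ⟨⟨_, SimpleGraph.turanGraph_cliqueFree hr0, rfl⟩, ?_⟩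
  rintro _ ⟨G, hG, rfl⟩
  rw [degPowerSum_turanGraph p hr0]
  exact degPowerSum_le hr0 hp hn.1 hn.2 G hG
end

section
/- For every integer r ≥ 2, real p > 0 and integer n ≥ 1, φ(r,p,n) equals the maximum of ∑_{i=1}^r n_i (n − n_i)^p taken over all r-tuples of nonnegative integers n_1, …, n_r with n_1 + … + n_r = n. Equivalently, among K_{r+1}-free graphs on n vertices, the maximum of f(p,G) is attained by a complete multipartite graph with at most r parts. -/
open Finset

/-- Erdős's degree majorization: a `K_{r+1}`-free graph on `S` is dominated degreewise by a
complete multipartite graph on `S` with at most `r` parts. -/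
theorem exists_coloring_card_adj_le {V : Type*} [DecidableEq V] (G : SimpleGraph V)
    [DecidableRel G.Adj] (r : ℕ) (S : Finset V) (hS : G.CliqueFreeOn S (r + 1)) :
    ∃ c : V → ℕ, (∀ v ∈ S, c v < r) ∧
      ∀ u ∈ S, #{v ∈ S | G.Adj u v} ≤ #{v ∈ S | c v ≠ c u} := by
  induction r generalizing S with
  | zero =>
    have hmem : ∀ v, v ∉ S := fun v hv =>
      hS (t := {v}) (by simpa using hv) (by simp [SimpleGraph.isNClique_iff])
    exact ⟨fun _ => 0, fun v hv => absurd hv (hmem v), fun v hv => absurd hv (hmem v)⟩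
  | succ r ih =>
    rcases S.eq_empty_or_nonempty with rfl | hne
    · exact ⟨fun _ => 0, by simp, by simp⟩
    obtain ⟨u, hu, hmax⟩ := S.exists_max_image (fun u => #{v ∈ S | G.Adj u v}) hne
    set N := {v ∈ S | G.Adj u v} with hN
    have hNS : N ⊆ S := filter_subset _ _
    have hfree : G.CliqueFreeOn N (r + 1) := by
      intro t ht htc
      refine hS (t := insert u t) ?_ (htc.insert fun b hb => ?_)
      · intro x hx
        rcases Finset.mem_insert.1 (Finset.mem_coe.1 hx) with rfl | hx
        · exact hu
        · exact hNS (ht hx)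
      · exact (mem_filter.1 (Finset.mem_coe.1 (ht hb))).2
    obtain ⟨c, hc, hdeg⟩ := ih N hfree
    refine ⟨fun v => if v ∈ N then c v else r, fun v _ => ?_, fun w hw => ?_⟩
    · by_cases hv : v ∈ N
      · simpa [hv] using (hc v hv).trans (Nat.lt_succ_self r)
      · simp [hv]
    · by_cases hwN : w ∈ N
      · calc #{v ∈ S | G.Adj w v}
            ≤ #({v ∈ N | G.Adj w v} ∪ S \ N) := card_le_card fun v hv => by
              simp only [mem_filter, mem_union, mem_sdiff] at hv ⊢
              tauto
          _ ≤ #{v ∈ N | G.Adj w v} + #(S \ N) := card_union_le _ _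
          _ ≤ #{v ∈ N | c v ≠ c w} + #(S \ N) := Nat.add_le_add_right (hdeg w hwN) _
          _ = #({v ∈ N | c v ≠ c w} ∪ S \ N) := (card_union_of_disjoint
              (disjoint_sdiff.mono_left (filter_subset _ _))).symm
          _ ≤ _ := card_le_card fun v hv => by
              have hcw := hc w hwN
              rcases mem_union.1 hv with h | h
              · obtain ⟨h₁, h₂⟩ := mem_filter.1 h
                simpa [hwN, h₁, hNS h₁] using h₂
              · obtain ⟨h₁, h₂⟩ := mem_sdiff.1 h
                simpa [hwN, h₁, h₂] using hcw.ne'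
      · refine (hmax w hw).trans (card_le_card fun v hv => ?_)
        simpa [hwN, hv, hNS hv] using (hc v hv).ne

/-- Grouping vertices by colour in the degree power sum of a complete multipartite graph. -/
theorem sum_card_color_ne_rpow {V : Type*} [Fintype V] {r : ℕ} (p : ℝ) (c : V → Fin r) :
    ∑ u, (#{v | c v ≠ c u} : ℝ) ^ p =
      ∑ i, (#{v | c v = i} : ℝ) * ((Fintype.card V : ℝ) - #{v | c v = i}) ^ p := by
  have hcard (i : Fin r) : (#{v | c v ≠ i} : ℝ) = (Fintype.card V : ℝ) - #{v | c v = i} := by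
    have h := card_filter_add_card_filter_not (s := (univ : Finset V)) (fun v => c v = i)
    rw [card_univ] at h
    rw [← h]
    push_cast
    ring
  simp_rw [hcard]
  rw [← sum_fiberwise_of_maps_to (s := univ) (t := univ) (g := c) (fun _ _ => mem_univ _)]
  refine sum_congr rfl fun i _ => ?_
  rw [sum_congr rfl (g := fun _ => ((Fintype.card V : ℝ) - #{v | c v = i}) ^ p)
    fun u hu => by rw [(mem_filter.1 hu).2]]
  simp

theorem degPowerSum_le_of_cliqueFree {r n : ℕ} {p : ℝ} (hp : 0 < p)
    (G : SimpleGraph (Fin n)) (hG : G.CliqueFree (r + 1)) :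
    ∃ m : Fin r → ℕ, (∑ i, m i) = n ∧
      degPowerSum p G ≤ ∑ i, (m i : ℝ) * ((n : ℝ) - (m i : ℝ)) ^ p := by
  classical
  obtain ⟨c, hc, hdeg⟩ := exists_coloring_card_adj_le G r univ hG.cliqueFreeOn
  let c' : Fin n → Fin r := fun v => ⟨c v, hc v (mem_univ v)⟩
  refine ⟨fun i => #{v | c' v = i}, ?_, ?_⟩
  · simpa using (card_eq_sum_card_fiberwise (s := univ) (t := univ) (f := c')
      fun _ _ => mem_coe.2 (mem_univ _)).symm
  · have h := sum_card_color_ne_rpow p c'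
    rw [Fintype.card_fin] at h
    rw [← h, degPowerSum]
    refine sum_le_sum fun u _ => Real.rpow_le_rpow (by positivity) ?_ hp.le
    have := hdeg u (mem_univ u)
    rw [Nat.cast_le, ← SimpleGraph.card_neighborFinset_eq_degree,
      SimpleGraph.neighborFinset_eq_filter]
    convert this using 3
    simp [c', Fin.ext_iff]

theorem exists_cliqueFree_degPowerSum_eq {r : ℕ} (p : ℝ) (m : Fin r → ℕ) :
    ∃ G : SimpleGraph (Fin (∑ i, m i)), G.CliqueFree (r + 1) ∧
      ∑ i, (m i : ℝ) * (((∑ i, m i : ℕ) : ℝ) - (m i : ℝ)) ^ p = degPowerSum p G := by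
  classical
  let c : Fin (∑ i, m i) → Fin r := fun v => (finSigmaFinEquiv.symm v).1
  have hm (i : Fin r) : #{v | c v = i} = m i := by
    rw [← Fintype.card_subtype, ← Fintype.card_fin (m i)]
    exact Fintype.card_congr ((finSigmaFinEquiv.symm.subtypeEquiv fun _ => Iff.rfl).trans
      (Equiv.sigmaSubtype i))
  refine ⟨(⊤ : SimpleGraph (Fin r)).comap c, ?_, ?_⟩
  · have hcol : ((⊤ : SimpleGraph (Fin r)).comap c).Colorable r :=
      ⟨SimpleGraph.Hom.comap c ⊤⟩
    exact hcol.cliqueFree (Nat.lt_succ_self r)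
  · have h := sum_card_color_ne_rpow p c
    simp_rw [hm, Fintype.card_fin] at h
    rw [← h, degPowerSum]
    refine sum_congr rfl fun u _ => ?_
    rw [← SimpleGraph.card_neighborFinset_eq_degree, SimpleGraph.neighborFinset_eq_filter]
    congr 3
    ext v
    simp [eq_comm]

theorem stmt2 (r : ℕ) (hr : 2 ≤ r) (p : ℝ) (hp : 0 < p) (n : ℕ) (hn : 1 ≤ n) :
    phiClique r p n =
      sSup {x | ∃ m : Fin r → ℕ, (∑ i, m i) = n ∧
        x = ∑ i, (m i : ℝ) * ((n : ℝ) - (m i : ℝ)) ^ p} := by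
  set A := {x | ∃ G : SimpleGraph (Fin n), G.CliqueFree (r + 1) ∧ x = degPowerSum p G} with hA
  set B := {x | ∃ m : Fin r → ℕ, (∑ i, m i) = n ∧
        x = ∑ i, (m i : ℝ) * ((n : ℝ) - (m i : ℝ)) ^ p} with hB
  have hBA : B ⊆ A := by
    rintro x ⟨m, rfl, rfl⟩
    exact exists_cliqueFree_degPowerSum_eq p m
  have hAB : ∀ x ∈ A, ∃ y ∈ B, x ≤ y := by
    rintro x ⟨G, hG, rfl⟩
    obtain ⟨m, hm, hle⟩ := degPowerSum_le_of_cliqueFree hp G hG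
    exact ⟨_, ⟨m, hm, rfl⟩, hle⟩
  have hAbdd : BddAbove A := by
    refine ((Set.finite_range fun G : SimpleGraph (Fin n) => degPowerSum p G).subset ?_).bddAbove
    rintro x ⟨G, -, rfl⟩
    exact ⟨G, rfl⟩
  have hAne : A.Nonempty := ⟨_, ⊥, SimpleGraph.cliqueFree_bot (by omega), rfl⟩
  obtain ⟨y, hy, -⟩ := hAB _ hAne.some_mem
  refine le_antisymm (csSup_le hAne fun x hx => ?_) (csSup_le_csSup hAbdd ⟨y, hy⟩ hBA)
  obtain ⟨z, hz, hxz⟩ := hAB x hx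
  exact hxz.trans (le_csSup (hAbdd.mono hBA) hz)
end

section
/- Fix an integer r ≥ 2 and a real p > 0. If real numbers 0 ≤ x_1 ≤ x_2 ≤ … ≤ x_r with x_1 + … + x_r = 1 attain the maximum of ∑_{i=1}^r x_i (1 − x_i)^p over all such tuples, then x_1 = x_2 = … = x_{r−1}. -/
open Finset

/-- Spreading a pair of points apart strictly increases the sum of a strictly convex function. -/
theorem StrictConvexOn.add_lt_add_of_add_eq {s : Set ℝ} {f : ℝ → ℝ} (hf : StrictConvexOn ℝ s f)
    {u v a b : ℝ} (hu : u ∈ s) (hv : v ∈ s) (hua : u < a) (hub : u < b) (h : a + b = u + v) :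
    f a + f b < f u + f v := by
  have hav : a < v := by linarith
  have huv : u < v := hua.trans hav
  have hd : 0 < v - u := by linarith
  have ht : 0 < (v - a) / (v - u) := div_pos (by linarith) hd
  have hs : 0 < (a - u) / (v - u) := div_pos (by linarith) hd
  have hts : (v - a) / (v - u) + (a - u) / (v - u) = 1 := by field_simp; ring
  have ha := hf.2 hu hv huv.ne ht hs hts
  have hb := hf.2 hu hv huv.ne hs ht (by linarith)
  have ea : (v - a) / (v - u) * u + (a - u) / (v - u) * v = a := by field_simp; ring
  have eb : (a - u) / (v - u) * u + (v - a) / (v - u) * v = b := by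
    obtain rfl : b = u + v - a := by linarith
    field_simp; ring
  simp only [smul_eq_mul, ea, eb] at ha hb
  have := congrArg (· * (f u + f v)) hts
  simp only [add_mul, mul_add, one_mul] at this
  linarith

theorem hasDerivAt_mul_one_sub_rpow (p : ℝ) {x : ℝ} (hx : x < 1) :
    HasDerivAt (fun x : ℝ => x * (1 - x) ^ p) ((1 - x) ^ p - p * x * (1 - x) ^ (p - 1)) x := by
  have h := (hasDerivAt_id x).mul
    (((hasDerivAt_id x).const_sub 1).rpow_const (p := p) (Or.inl (sub_pos.2 hx).ne'))
  refine h.congr_deriv ?_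
  simp only [id]
  ring

theorem deriv_deriv_mul_one_sub_rpow (p : ℝ) {x : ℝ} (hx : x < 1) :
    deriv^[2] (fun x : ℝ => x * (1 - x) ^ p) x = p * (1 - x) ^ (p - 2) * ((p + 1) * x - 2) := by
  have hpos : 0 < 1 - x := sub_pos.2 hx
  have heq : deriv (fun x : ℝ => x * (1 - x) ^ p) =ᶠ[nhds x]
      fun x => (1 - x) ^ p - p * (x * (1 - x) ^ (p - 1)) := by
    filter_upwards [Iio_mem_nhds hx] with y hy
    rw [(hasDerivAt_mul_one_sub_rpow p hy).deriv, mul_assoc]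
  have h1 := ((hasDerivAt_id x).const_sub 1).rpow_const (p := p) (Or.inl hpos.ne')
  have h := h1.sub ((hasDerivAt_mul_one_sub_rpow (p - 1) hx).const_mul p)
  have e : (1 - x) ^ (p - 1) = (1 - x) ^ (p - 2) * (1 - x) := by
    rw [← Real.rpow_add_one hpos.ne']; ring_nf
  have e2 : p - 1 - 1 = p - 2 := by ring
  simp only [Function.iterate_succ, Function.iterate_zero, Function.comp, id]
  rw [heq.deriv_eq]
  refine h.deriv.trans ?_
  simp only [id, e, e2]
  ring

theorem continuous_mul_one_sub_rpow {p : ℝ} (hp : 0 < p) :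
    Continuous (fun x : ℝ => x * (1 - x) ^ p) :=
  continuous_id.mul ((continuous_const.sub continuous_id).rpow_const fun _ => Or.inr hp.le)

theorem strictConcaveOn_mul_one_sub_rpow {p c : ℝ} (hp : 0 < p) (hc : c ≤ 1)
    (hpc : (p + 1) * c ≤ 2) :
    StrictConcaveOn ℝ (Set.Icc 0 c) (fun x : ℝ => x * (1 - x) ^ p) := by
  refine strictConcaveOn_of_deriv2_neg (convex_Icc _ _)
    (continuous_mul_one_sub_rpow hp).continuousOn fun x hx => ?_
  rw [interior_Icc] at hx
  have hx1 : x < 1 := hx.2.trans_le hc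
  rw [deriv_deriv_mul_one_sub_rpow p hx1]
  refine mul_neg_of_pos_of_neg (mul_pos hp (Real.rpow_pos_of_pos (sub_pos.2 hx1) _)) ?_
  nlinarith [hx.2]

theorem strictConvexOn_mul_one_sub_rpow {p c : ℝ} (hp : 0 < p) (hpc : 2 ≤ (p + 1) * c) :
    StrictConvexOn ℝ (Set.Icc c 1) (fun x : ℝ => x * (1 - x) ^ p) := by
  refine strictConvexOn_of_deriv2_pos (convex_Icc _ _)
    (continuous_mul_one_sub_rpow hp).continuousOn fun x hx => ?_
  rw [interior_Icc] at hx
  rw [deriv_deriv_mul_one_sub_rpow p hx.2]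
  refine mul_pos (mul_pos hp (Real.rpow_pos_of_pos (sub_pos.2 hx.2) _)) ?_
  nlinarith [hx.1]

theorem Finset.sum_comp_update_update {ι : Type*} [Fintype ι] [DecidableEq ι] (g : ℝ → ℝ)
    (x : ι → ℝ) {i j : ι} (hij : i ≠ j) (a b : ℝ) :
    ∑ k, g (Function.update (Function.update x i a) j b k) + (g (x i) + g (x j)) =
      ∑ k, g (x k) + (g a + g b) := by
  have hi : i ∈ univ.erase j := by simp [hij]
  have h : ∀ y : ι → ℝ, ∑ k, g (y k) = g (y j) + (g (y i) + ∑ k ∈ (univ.erase j).erase i, g (y k)) :=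
    fun y => by rw [add_sum_erase _ (fun k => g (y k)) hi, add_sum_erase _ (fun k => g (y k)) (mem_univ j)]
  have hrest : ∑ k ∈ (univ.erase j).erase i, g (Function.update (Function.update x i a) j b k) =
      ∑ k ∈ (univ.erase j).erase i, g (x k) := by
    refine sum_congr rfl fun k hk => ?_
    simp only [mem_erase] at hk
    rw [Function.update_of_ne hk.2.1, Function.update_of_ne hk.1]
  rw [h, h x, hrest, Function.update_self, Function.update_of_ne hij, Function.update_self]
  ring

/-- At a maximizer over sorted tuples, moving mass between two coordinates does not help. -/
theorem add_le_add_of_sorted_maximizer {r : ℕ} (g : ℝ → ℝ) {x : Fin r → ℝ} (hx0 : ∀ i, 0 ≤ x i)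
    (hxsum : ∑ i, x i = 1)
    (hmax : ∀ y : Fin r → ℝ, (∀ i, 0 ≤ y i) → Monotone y → ∑ i, y i = 1 →
      ∑ i, g (y i) ≤ ∑ i, g (x i))
    {i j : Fin r} (hij : i ≠ j) {a b : ℝ} (ha : 0 ≤ a) (hb : 0 ≤ b) (hab : a + b = x i + x j) :
    g a + g b ≤ g (x i) + g (x j) := by
  set y := Function.update (Function.update x i a) j b with hy
  have hy0 : ∀ k, 0 ≤ y k := fun k => by
    simp only [hy, Function.update_apply]
    split_ifs
    exacts [hb, ha, hx0 k]
  have hysum : ∑ k, y k = 1 := by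
    have := sum_comp_update_update id x hij a b
    simp only [id] at this
    linarith
  have hle := hmax (y ∘ Tuple.sort y) (fun k => hy0 _) (Tuple.monotone_sort y)
    ((Equiv.sum_comp (Tuple.sort y) y).trans hysum)
  have hperm : ∑ k, g ((y ∘ Tuple.sort y) k) = ∑ k, g (y k) :=
    Equiv.sum_comp (Tuple.sort y) fun k => g (y k)
  have := sum_comp_update_update g x hij a b
  linarith

theorem stmt4 (r : ℕ) (hr : 2 ≤ r) (p : ℝ) (hp : 0 < p)
    (x : Fin r → ℝ) (hx0 : ∀ i, 0 ≤ x i) (hxmono : Monotone x) (hxsum : ∑ i, x i = 1)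
    (hmax : ∀ y : Fin r → ℝ, (∀ i, 0 ≤ y i) → Monotone y → ∑ i, y i = 1 →
      ∑ i, y i * (1 - y i) ^ p ≤ ∑ i, x i * (1 - x i) ^ p) :
    ∀ i j : Fin r, (i : ℕ) < r - 1 → (j : ℕ) < r - 1 → x i = x j := by
  have hexch : ∀ {i j : Fin r}, i ≠ j → ∀ {a b : ℝ}, 0 ≤ a → 0 ≤ b → a + b = x i + x j → _ :=
    add_le_add_of_sorted_maximizer (fun t => t * (1 - t) ^ p) hx0 hxsum hmax
  suffices H : ∀ i j : Fin r, (j : ℕ) < r - 1 → ¬ x i < x j from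
    fun i j hi hj => le_antisymm (not_lt.1 (H j i hi)) (not_lt.1 (H i j hj))
  intro i j hj hlt
  have hx1 : ∀ k, x k ≤ 1 := fun k =>
    hxsum ▸ single_le_sum (fun l _ => hx0 l) (mem_univ k)
  rcases le_or_gt ((p + 1) * x j) 2 with hc | hc
  · have hconc := strictConcaveOn_mul_one_sub_rpow hp (hx1 j) hc
    have hlt' := hconc.2 ⟨hx0 i, hlt.le⟩ ⟨hx0 j, le_rfl⟩ hlt.ne
      one_half_pos one_half_pos (add_halves 1)
    have hm : 0 ≤ 1 / 2 * x i + 1 / 2 * x j := by linarith [hx0 i, hx0 j]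
    have := hexch (ne_of_apply_ne x hlt.ne) hm hm (by ring)
    simp only [smul_eq_mul] at hlt' this
    linarith
  · set l : Fin r := ⟨r - 1, by omega⟩ with hl
    have hjl : j < l := hj
    have hxl : x j ≤ x l := hxmono hjl.le
    have hsum : x j + x l ≤ 1 := by
      rw [← hxsum, ← sum_pair (f := x) hjl.ne]
      exact sum_le_univ_sum_of_nonneg hx0
    have hp1 : 0 < p + 1 := by linarith
    have hcpos : 0 < 2 / (p + 1) := by positivity
    have hcj : 2 / (p + 1) < x j := by rw [div_lt_iff₀ hp1]; linarith
    have hconv := strictConvexOn_mul_one_sub_rpow hp (c := 2 / (p + 1))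
      (mul_div_cancel₀ 2 hp1.ne').ge
    have hlt' := hconv.add_lt_add_of_add_eq (v := x j + x l - 2 / (p + 1))
      ⟨le_rfl, by linarith⟩ ⟨by linarith, by linarith⟩ hcj (hcj.trans_le hxl) (by ring)
    have := hexch hjl.ne (a := 2 / (p + 1)) (b := x j + x l - 2 / (p + 1)) hcpos.le
      (by linarith) (by ring)
    linarith
end

section
/- For every integer r ≥ 2 and every real p ≥ r + ⌈√(2r)⌉, one has ψ(r,p) > (1 + ε) · ((r−1)/r)^p, where ε = ⌈√(2r)⌉ / ( (r + ⌈√(2r)⌉)^2 · (r − 1) ) > 0. -/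
open Finset

/-- `ψ(r,p)`: the maximum of `∑ x_i (1 - x_i)^p` over the standard simplex. -/
noncomputable def psiMax (r : ℕ) (p : ℝ) : ℝ :=
  sSup {y | ∃ x : Fin r → ℝ, (∀ i, 0 ≤ x i) ∧ ∑ i, x i = 1 ∧
    y = ∑ i, x i * (1 - x i) ^ p}

theorem bddAbove_psiMax_set (r : ℕ) {p : ℝ} (hp : 0 ≤ p) :
    BddAbove {y | ∃ x : Fin r → ℝ, (∀ i, 0 ≤ x i) ∧ ∑ i, x i = 1 ∧
      y = ∑ i, x i * (1 - x i) ^ p} := by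
  refine ⟨1, ?_⟩
  rintro y ⟨x, hx, hsum, rfl⟩
  rw [← hsum]
  refine Finset.sum_le_sum fun i _ => mul_le_of_le_one_right (hx i) ?_
  have hi : x i ≤ 1 := hsum ▸ Finset.single_le_sum (fun j _ => hx j) (Finset.mem_univ i)
  exact Real.rpow_le_one (by linarith) (by linarith [hx i]) hp

/-- Lower bound for `ψ(n+1,p)` from the point with `n` coordinates equal to `y`. -/
theorem le_psiMax_succ (n : ℕ) {p y : ℝ} (hp : 0 ≤ p) (hy : 0 ≤ y) (hny : n * y ≤ 1) :
    (1 - n * y) * (n * y) ^ p + n * (y * (1 - y) ^ p) ≤ psiMax (n + 1) p := by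
  refine le_csSup (bddAbove_psiMax_set _ hp) ⟨Fin.cons (1 - n * y) fun _ => y, ?_, ?_, ?_⟩
  · intro i
    refine Fin.cases ?_ (fun j => ?_) i
    · simpa using hny
    · simpa using hy
  · simp [Fin.sum_univ_succ]
  · simp [Fin.sum_univ_succ]

theorem quadratic_le_one_add_pow {d : ℝ} (hd : 0 ≤ d) (m : ℕ) :
    1 + m * d + m * (m - 1) / 2 * d ^ 2 ≤ (1 + d) ^ m := by
  induction m with
  | zero => simp
  | succ m ih =>
    have h : (0 : ℝ) ≤ m * (m - 1) / 2 * d ^ 3 := by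
      rcases m with _ | m
      · simp
      · push_cast
        have : (m : ℝ) + 1 - 1 = m := by ring
        rw [this]
        positivity
    rw [pow_succ]
    push_cast
    have := mul_le_mul_of_nonneg_right ih (by linarith : 0 ≤ 1 + d)
    linear_combination this + h

theorem one_add_le_mul_one_add_pow {n k : ℕ} (hn : 1 ≤ n) (hk : 2 * ((n : ℝ) + 1) ≤ k ^ 2) :
    1 + (k : ℝ) / ((n + 1 + k) ^ 2 * n) ≤
      n / (n + 1 + k) * (1 + (k : ℝ) / ((n + 1 + k) * n)) ^ (n + 1 + k) := by
  have hn0 : (0 : ℝ) < n := by exact_mod_cast hn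
  have hm : (0 : ℝ) < n + 1 + k := by positivity
  refine le_trans ?_ (mul_le_mul_of_nonneg_left
    (quadratic_le_one_add_pow (by positivity) (n + 1 + k)) (by positivity))
  push_cast
  rw [← sub_nonneg]
  have key : (n : ℝ) / (n + 1 + k) * (1 + (n + 1 + k) * (k / ((n + 1 + k) * n)) +
      (n + 1 + k) * (n + 1 + k - 1) / 2 * (k / ((n + 1 + k) * n)) ^ 2) -
      (1 + (k : ℝ) / ((n + 1 + k) ^ 2 * n)) =
      (n + k) * (k ^ 2 - 2 * (n + 1)) / (2 * n * (n + 1 + k) ^ 2) := by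
    field_simp
    ring
  rw [key]
  have := sub_nonneg.2 hk
  positivity

theorem stmt6 (r : ℕ) (hr : 2 ≤ r) (p : ℝ)
    (hp : (r : ℝ) + (⌈Real.sqrt (2 * r)⌉₊ : ℝ) ≤ p) :
    0 < (⌈Real.sqrt (2 * r)⌉₊ : ℝ) /
        (((r : ℝ) + (⌈Real.sqrt (2 * r)⌉₊ : ℝ)) ^ 2 * ((r : ℝ) - 1)) ∧
    (1 + (⌈Real.sqrt (2 * r)⌉₊ : ℝ) /
        (((r : ℝ) + (⌈Real.sqrt (2 * r)⌉₊ : ℝ)) ^ 2 * ((r : ℝ) - 1))) *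
      (((r : ℝ) - 1) / r) ^ p < psiMax r p := by
  obtain ⟨n, rfl⟩ : ∃ n, r = n + 1 := ⟨r - 1, by omega⟩
  have hn : 1 ≤ n := by omega
  have hn0 : (0 : ℝ) < n := by exact_mod_cast hn
  have hk : 2 * ((n : ℝ) + 1) ≤ (⌈Real.sqrt (2 * (n + 1 : ℕ))⌉₊ : ℝ) ^ 2 := by
    have := (Real.sqrt_le_left (Nat.cast_nonneg _)).1
      (Nat.le_ceil (Real.sqrt (2 * (n + 1 : ℕ))))
    push_cast at this ⊢
    exact this
  have hk0 : 0 < ⌈Real.sqrt (2 * (n + 1 : ℕ))⌉₊ := Nat.ceil_pos.2 (by positivity)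
  generalize ⌈Real.sqrt (2 * (n + 1 : ℕ))⌉₊ = k at *
  have hk1 : (0 : ℝ) < k := by exact_mod_cast hk0
  push_cast at hp ⊢
  rw [add_sub_cancel_right]
  refine ⟨by positivity, ?_⟩
  have hm : (0 : ℝ) < n + 1 + k := by positivity
  have hp0 : 0 ≤ p := hm.le.trans hp
  have hny : (n : ℝ) * (1 / (n + 1 + k)) < 1 := by
    rw [mul_one_div, div_lt_one hm]
    linarith
  refine lt_of_lt_of_le ?_ (le_psiMax_succ n hp0 (y := 1 / (n + 1 + k)) (by positivity) hny.le)
  have hpos : 0 < (1 - (n : ℝ) * (1 / (n + 1 + k))) * (n * (1 / (n + 1 + k))) ^ p :=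
    mul_pos (sub_pos.2 hny) (by positivity)
  have hfac : 1 - 1 / ((n : ℝ) + 1 + k) =
      (1 + (k : ℝ) / ((n + 1 + k) * n)) * (n / (n + 1)) := by
    field_simp
    ring
  have hpow : (1 + (k : ℝ) / ((n + 1 + k) * n)) ^ (n + 1 + k) ≤
      (1 + (k : ℝ) / ((n + 1 + k) * n)) ^ p := by
    rw [← Real.rpow_natCast]
    refine Real.rpow_le_rpow_of_exponent_le ?_ (by exact_mod_cast hp)
    exact le_add_of_nonneg_right (by positivity)
  have hmain := (one_add_le_mul_one_add_pow hn hk).trans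
    (mul_le_mul_of_nonneg_left hpow (by positivity))
  have hq : (0 : ℝ) ≤ ((n : ℝ) / (n + 1)) ^ p := by positivity
  have hscaled := mul_le_mul_of_nonneg_right hmain hq
  rw [hfac, Real.mul_rpow (x := 1 + (k : ℝ) / ((n + 1 + k) * n)) (by positivity) (by positivity)]
  linear_combination hscaled + hpos
end

section
/- For every fixed integer r ≥ 2, the function p ↦ ((r−1)/p) · (1 + (p − r)/(p(r−1)))^p is monotone increasing in p on the interval p ≥ r. -/
/-- The derivative of `x ↦ x * c + x * log (x - 1) - (x + 1) * log x` at `p > 1`. -/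
theorem hasDerivAt_mul_log_sub_one_sub (c : ℝ) {p : ℝ} (hp : 1 < p) :
    HasDerivAt (fun x : ℝ => x * c + x * Real.log (x - 1) - (x + 1) * Real.log x)
      (c + Real.log (p - 1) - Real.log p + 1 / (p * (p - 1))) p := by
  have hp0 : p ≠ 0 := by linarith
  have hp1 : p - 1 ≠ 0 := by linarith
  have hlog : HasDerivAt (fun x : ℝ => Real.log (x - 1)) (1 / (p - 1)) p :=
    ((hasDerivAt_id p).sub_const 1).log hp1
  have h := (((hasDerivAt_id p).mul_const c).add ((hasDerivAt_id p).mul hlog)).sub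
    (((hasDerivAt_id p).add_const 1).mul (Real.hasDerivAt_log hp0))
  refine h.congr_deriv ?_
  simp only [id]
  field_simp
  ring

theorem monotoneOn_mul_log_sub_one_sub {r : ℝ} (hr : 1 < r) :
    MonotoneOn (fun x : ℝ => x * Real.log (r / (r - 1)) + x * Real.log (x - 1)
      - (x + 1) * Real.log x) (Set.Ici r) := by
  have hd (p : ℝ) (hp : r ≤ p) :=
    hasDerivAt_mul_log_sub_one_sub (Real.log (r / (r - 1))) (hr.trans_le hp)
  refine monotoneOn_of_deriv_nonneg (convex_Ici r)
    (fun p hp => (hd p hp).continuousAt.continuousWithinAt)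
    (fun p hp => (hd p (interior_subset hp)).differentiableAt.differentiableWithinAt) ?_
  intro p hp
  have hp : r ≤ p := interior_subset hp
  have hr1 : 0 < r - 1 := by linarith
  have hp1 : 0 < p - 1 := by linarith
  have hp0 : 0 < p := by linarith
  have hr0 : 0 < r := by linarith
  rw [(hd p hp).deriv, Real.log_div hr0.ne' hr1.ne']
  have hpos : 0 ≤ 1 / (p * (p - 1)) := by positivity
  have hle : Real.log (p * (r - 1)) ≤ Real.log (r * (p - 1)) :=
    Real.log_le_log (by positivity) (by linarith)
  rw [Real.log_mul hp0.ne' hr1.ne', Real.log_mul hr0.ne' hp1.ne'] at hle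
  linarith

theorem div_mul_one_add_rpow_eq_mul_exp {r p : ℝ} (hr : 1 < r) (hp : 1 < p) :
    ((r - 1) / p) * (1 + (p - r) / (p * (r - 1))) ^ p =
      (r - 1) * Real.exp (p * Real.log (r / (r - 1)) + p * Real.log (p - 1)
        - (p + 1) * Real.log p) := by
  have hr1 : 0 < r - 1 := by linarith
  have hp1 : 0 < p - 1 := by linarith
  have hp0 : 0 < p := by linarith
  have hr0 : 0 < r := by linarith
  have hbase : 1 + (p - r) / (p * (r - 1)) = r / (r - 1) * (p - 1) / p := by
    field_simp
    ring
  rw [hbase, Real.rpow_def_of_pos (by positivity), Real.log_div (by positivity) hp0.ne',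
    Real.log_mul (by positivity) hp1.ne', div_mul_eq_mul_div, mul_div_assoc]
  rw [show p * Real.log (r / (r - 1)) + p * Real.log (p - 1) - (p + 1) * Real.log p =
    (Real.log (r / (r - 1)) + Real.log (p - 1) - Real.log p) * p - Real.log p by ring,
    Real.exp_sub, Real.exp_log hp0]

theorem stmt8 (r : ℕ) (hr : 2 ≤ r) :
    MonotoneOn (fun p : ℝ => (((r : ℝ) - 1) / p) *
      (1 + (p - (r : ℝ)) / (p * ((r : ℝ) - 1))) ^ p) (Set.Ici (r : ℝ)) := by
  have hr1 : (1 : ℝ) < r := by exact_mod_cast hr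
  refine MonotoneOn.congr (f₁ := fun p : ℝ => ((r : ℝ) - 1) *
    Real.exp (p * Real.log ((r : ℝ) / (r - 1)) + p * Real.log (p - 1) - (p + 1) * Real.log p))
    ?_ fun p hp => (div_mul_one_add_rpow_eq_mul_exp hr1 (hr1.trans_le hp)).symm
  intro p hp q hq hpq
  exact mul_le_mul_of_nonneg_left
    (Real.exp_le_exp.2 (monotoneOn_mul_log_sub_one_sub hr1 hp hq hpq)) (by linarith)
end

section
/- For every real p with 0 < p ≤ 3 and every integer n ≥ 1, φ(2,p,n) = f(p, T_2(n)); that is, among triangle-free graphs on n vertices, the sum of the p-th powers of the degrees is maximized by the complete bipartite graph with parts of sizes ⌊n/2⌋ and ⌈n/2⌉. -/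
open Finset

theorem sum_range_ite_even {M : Type*} [Semiring M] (A B : M) (n : ℕ) :
    ∑ i ∈ range n, (if i % 2 = 0 then A else B) = ((n + 1) / 2 : ℕ) * A + (n / 2 : ℕ) * B := by
  induction n with
  | zero => simp
  | succ k ih =>
    rw [sum_range_succ, ih]
    rcases Nat.even_or_odd' k with ⟨c, rfl | rfl⟩
    · rw [if_pos (by omega), show (2 * c + 1) / 2 = c by omega, show 2 * c / 2 = c by omega,
        show (2 * c + 1 + 1) / 2 = c + 1 by omega]
      push_cast
      rw [add_mul, one_mul, add_right_comm]
    · rw [if_neg (by omega), show (2 * c + 1) / 2 = c by omega,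
        show (2 * c + 1 + 1) / 2 = c + 1 by omega, show (2 * c + 1 + 1 + 1) / 2 = c + 1 by omega]
      push_cast
      rw [add_mul (c : M) 1 B, one_mul, add_assoc]

theorem degree_turanGraph_two (n : ℕ) (u : Fin n) :
    (SimpleGraph.turanGraph n 2).degree u = if (u : ℕ) % 2 = 0 then n / 2 else (n + 1) / 2 := by
  rw [← SimpleGraph.card_neighborFinset_eq_degree, SimpleGraph.neighborFinset_eq_filter,
    card_filter]
  simp only [SimpleGraph.turanGraph_adj]
  rw [Fin.sum_univ_eq_sum_range (fun i => if (u : ℕ) % 2 ≠ i % 2 then 1 else 0) n]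
  split_ifs with h
  · rw [sum_congr rfl (g := fun i => if i % 2 = 0 then 0 else 1), sum_range_ite_even]
    · simp
    · intro i _
      split_ifs <;> omega
  · rw [sum_congr rfl (g := fun i => if i % 2 = 0 then 1 else 0), sum_range_ite_even]
    · simp
    · intro i _
      split_ifs <;> omega

theorem sum_degree_pow_turanGraph_two (n k : ℕ) :
    ∑ u, (SimpleGraph.turanGraph n 2).degree u ^ k =
      (n + 1) / 2 * (n / 2) ^ k + n / 2 * ((n + 1) / 2) ^ k := by
  simp only [degree_turanGraph_two, ite_pow]
  rw [Fin.sum_univ_eq_sum_range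
    (fun i => if i % 2 = 0 then (n / 2) ^ k else ((n + 1) / 2) ^ k) n, sum_range_ite_even]
  simp

theorem mul_cube_add_mul_cube_le_balanced (a b : ℕ) :
    a * b ^ 3 + b * a ^ 3 ≤ (a + b + 1) / 2 * ((a + b) / 2) ^ 3
      + (a + b) / 2 * ((a + b + 1) / 2) ^ 3 := by
  obtain ⟨c, hc⟩ : ∃ c, c = (a + b) / 2 := ⟨_, rfl⟩
  obtain ⟨d, hd⟩ : ∃ d, d = (a + b + 1) / 2 := ⟨_, rfl⟩
  rw [← hc, ← hd]
  have hsum : a + b = c + d := by omega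
  have hprod : 0 ≤ ((a : ℤ) - c) * (a - d) := by
    rcases le_or_gt a c with h | h
    · exact mul_nonneg_of_nonpos_of_nonpos (by omega) (by omega)
    · exact mul_nonneg (by omega) (by omega)
  zify at hsum ⊢
  have hb : (b : ℤ) = c + d - a := by linarith
  have hle : (a : ℤ) * b ≤ c * d := by rw [hb]; nlinarith
  have hsq : 2 * ((c : ℤ) * d + a * b) ≤ (c + d) ^ 2 := by nlinarith [sq_nonneg ((c : ℤ) - d)]
  have key := mul_nonneg (sub_nonneg.2 hle) (sub_nonneg.2 hsq)
  have e1 : (a : ℤ) * b ^ 3 + b * a ^ 3 = a * b * ((c + d) ^ 2 - 2 * (a * b)) := by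
    rw [← hsum]; ring
  rw [e1]
  nlinarith

/-- The degree power sum of a triangle-free graph with maximum degree `Δ` is at most that of the
complete bipartite graph with parts of sizes `Δ` and `n - Δ`. -/
theorem SimpleGraph.CliqueFree.exists_sum_degree_pow_le {V : Type*} [Fintype V]
    {G : SimpleGraph V} [DecidableRel G.Adj] (hG : G.CliqueFree 3) (k : ℕ) :
    ∃ a b, a + b = Fintype.card V ∧ ∑ u, G.degree u ^ k ≤ a * b ^ k + b * a ^ k := by
  classical
  cases isEmpty_or_nonempty V
  · exact ⟨0, 0, by simp, by simp⟩
  obtain ⟨v, hv⟩ := G.exists_maximal_degree_vertex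
  have hcard : G.degree v + #(G.neighborFinset v)ᶜ = Fintype.card V := by
    rw [← G.card_neighborFinset_eq_degree v, card_add_card_compl]
  refine ⟨G.degree v, #(G.neighborFinset v)ᶜ, hcard, ?_⟩
  rw [← sum_add_sum_compl (G.neighborFinset v)]
  refine add_le_add ?_ ?_
  · rw [← G.card_neighborFinset_eq_degree v, ← smul_eq_mul]
    refine sum_le_card_nsmul _ _ _ fun u hu => Nat.pow_le_pow_left ?_ k
    rw [← G.card_neighborFinset_eq_degree u]
    refine card_le_card fun w hw => ?_
    simp only [mem_compl, SimpleGraph.mem_neighborFinset] at *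
    intro hvw
    exact hG {v, u, w} (SimpleGraph.is3Clique_triple_iff.2 ⟨hu, hvw, hw⟩)
  · rw [← smul_eq_mul #(G.neighborFinset v)ᶜ]
    refine sum_le_card_nsmul _ _ _ fun u _ => Nat.pow_le_pow_left ?_ k
    exact hv ▸ G.degree_le_maxDegree u

/-- On the natural numbers, `x ↦ x ^ p` with `0 < p ≤ 3` lies below an increasing affine function
of `x ^ 3` agreeing with it at `c` and `c + 1`. -/
theorem exists_affine_cube_bound {p : ℝ} (hp : 0 < p) (hp3 : p ≤ 3) (c : ℕ) :
    ∃ α β : ℝ, 0 ≤ β ∧ (∀ d : ℕ, (d : ℝ) ^ p ≤ α + β * (d : ℝ) ^ 3) ∧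
      ∀ d : ℕ, c ≤ d → d ≤ c + 1 → (d : ℝ) ^ p = α + β * (d : ℝ) ^ 3 := by
  have hconc := Real.concaveOn_rpow (p := p / 3) (by positivity) (by linarith)
  have hpow (d : ℕ) : ((d : ℝ) ^ 3) ^ (p / 3) = (d : ℝ) ^ p := by
    rw [← Real.rpow_natCast, ← Real.rpow_mul d.cast_nonneg]
    congr 1
    push_cast
    ring
  have hmem (d : ℕ) : (d : ℝ) ^ 3 ∈ Set.Ici (0 : ℝ) := Set.mem_Ici.2 (by positivity)
  have hlt {i j : ℕ} (h : i < j) : (i : ℝ) ^ 3 < (j : ℝ) ^ 3 := by gcongr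
  have hpos : 0 < ((c + 1 : ℕ) : ℝ) ^ 3 - (c : ℝ) ^ 3 := sub_pos.2 (hlt c.lt_succ_self)
  obtain ⟨β, hβ⟩ : ∃ β, β = (((c + 1 : ℕ) : ℝ) ^ p - (c : ℝ) ^ p) /
    (((c + 1 : ℕ) : ℝ) ^ 3 - (c : ℝ) ^ 3) := ⟨_, rfl⟩
  have hmul : β * (((c + 1 : ℕ) : ℝ) ^ 3 - (c : ℝ) ^ 3) = ((c + 1 : ℕ) : ℝ) ^ p - (c : ℝ) ^ p := by
    rw [hβ, div_mul_cancel₀ _ hpos.ne']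
  have heq : ∀ d : ℕ, c ≤ d → d ≤ c + 1 →
      (d : ℝ) ^ p = ((c : ℝ) ^ p - β * (c : ℝ) ^ 3) + β * (d : ℝ) ^ 3 := by
    intro d h1 h2
    obtain rfl | rfl : d = c ∨ d = c + 1 := by omega
    · ring
    · linarith
  refine ⟨(c : ℝ) ^ p - β * (c : ℝ) ^ 3, β, ?_, fun d => ?_, heq⟩
  · rw [hβ]
    refine div_nonneg (sub_nonneg.2 ?_) hpos.le
    exact Real.rpow_le_rpow (by positivity) (by push_cast; linarith) hp.le
  · rcases lt_or_ge d c with h | h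
    · have := hconc.slope_anti_adjacent (hmem d) (hmem (c + 1)) (hlt h) (hlt c.lt_succ_self)
      rw [hpow, hpow, hpow, ← hβ, le_div_iff₀ (sub_pos.2 (hlt h))] at this
      linarith
    rcases le_or_gt d (c + 1) with h' | h'
    · exact (heq d h h').le
    · have := hconc.slope_anti_adjacent (hmem c) (hmem d) (hlt c.lt_succ_self) (hlt h')
      rw [hpow, hpow, hpow, ← hβ, div_le_iff₀ (sub_pos.2 (hlt h'))] at this
      linarith

theorem degPowerSum_eq (p : ℝ) {V : Type*} [Fintype V] (G : SimpleGraph V)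
    [DecidableRel G.Adj] : degPowerSum p G = ∑ u, (G.degree u : ℝ) ^ p := by
  unfold degPowerSum
  congr!

theorem degPowerSum_le_turanGraph_two {p : ℝ} (hp : 0 < p) (hp3 : p ≤ 3) {n : ℕ}
    {G : SimpleGraph (Fin n)} (hG : G.CliqueFree 3) :
    degPowerSum p G ≤ degPowerSum p (SimpleGraph.turanGraph n 2) := by
  classical
  obtain ⟨α, β, hβ, hle, heq⟩ := exists_affine_cube_bound hp hp3 (n / 2)
  have hcubes : ∑ u, G.degree u ^ 3 ≤ ∑ u, (SimpleGraph.turanGraph n 2).degree u ^ 3 := by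
    obtain ⟨a, b, hab, h⟩ := hG.exists_sum_degree_pow_le 3
    rw [Fintype.card_fin] at hab
    subst hab
    rw [sum_degree_pow_turanGraph_two]
    exact h.trans (mul_cube_add_mul_cube_le_balanced a b)
  have hcubes' : ∑ u, (G.degree u : ℝ) ^ 3 ≤
      ∑ u, ((SimpleGraph.turanGraph n 2).degree u : ℝ) ^ 3 := by exact_mod_cast hcubes
  rw [degPowerSum_eq, degPowerSum_eq]
  calc ∑ u, (G.degree u : ℝ) ^ p ≤ ∑ u, (α + β * (G.degree u : ℝ) ^ 3) :=
        sum_le_sum fun u _ => hle _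
    _ ≤ ∑ u, (α + β * ((SimpleGraph.turanGraph n 2).degree u : ℝ) ^ 3) := by
        simp only [sum_add_distrib, ← mul_sum]
        gcongr
    _ = ∑ u, ((SimpleGraph.turanGraph n 2).degree u : ℝ) ^ p := by
        refine sum_congr rfl fun u _ => (heq _ ?_ ?_).symm <;>
          rw [degree_turanGraph_two] <;> split_ifs <;> omega

theorem stmt10 (p : ℝ) (hp : 0 < p) (hp3 : p ≤ 3) (n : ℕ) (hn : 1 ≤ n) :
    phiClique 2 p n = degPowerSum p (SimpleGraph.turanGraph n 2) := by
  refine IsGreatest.csSup_eq ⟨⟨_, SimpleGraph.turanGraph_cliqueFree two_pos, rfl⟩, ?_⟩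
  rintro _ ⟨G, hG, rfl⟩
  exact degPowerSum_le_turanGraph_two hp hp3 hG
end

section
/- For every real p with 2 < p ≤ 3, the function g(x) = (1 + x)(1 − x)^p + (1 − x)(1 + x)^p is concave on the interval [−1, 1]. -/
/-- The two-term Chebyshev (rearrangement) inequality for the functions `id` and `· ^ q`. -/
theorem mul_rpow_add_mul_rpow_le {a b q : ℝ} (ha : 0 ≤ a) (hb : 0 ≤ b) (hq : 0 ≤ q) :
    b * a ^ q + a * b ^ q ≤ a * a ^ q + b * b ^ q := by
  rcases le_total a b with h | h
  · nlinarith [Real.rpow_le_rpow ha h hq]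
  · nlinarith [Real.rpow_le_rpow hb h hq]

theorem hasDerivAt_one_sub_rpow {p : ℝ} (hp : 1 ≤ p) (x : ℝ) :
    HasDerivAt (fun x : ℝ => (1 - x) ^ p) (-(p * (1 - x) ^ (p - 1))) x := by
  convert ((hasDerivAt_id' x).const_sub 1).rpow_const (Or.inr hp) using 1
  ring

theorem hasDerivAt_one_add_rpow {p : ℝ} (hp : 1 ≤ p) (x : ℝ) :
    HasDerivAt (fun x : ℝ => (1 + x) ^ p) (p * (1 + x) ^ (p - 1)) x := by
  convert ((hasDerivAt_id' x).const_add 1).rpow_const (Or.inr hp) using 1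
  ring

theorem stmt11 (p : ℝ) (hp2 : 2 < p) (hp3 : p ≤ 3) :
    ConcaveOn ℝ (Set.Icc (-1 : ℝ) 1)
      (fun x : ℝ => (1 + x) * (1 - x) ^ p + (1 - x) * (1 + x) ^ p) := by
  have hadd (x : ℝ) : HasDerivAt (fun x : ℝ => 1 + x) 1 x := (hasDerivAt_id' x).const_add 1
  have hsub (x : ℝ) : HasDerivAt (fun x : ℝ => 1 - x) (-1) x := (hasDerivAt_id' x).const_sub 1
  have hp : 1 ≤ p := by linarith
  have hp' : 1 ≤ p - 1 := by linarith
  have hd1 (x : ℝ) := ((hadd x).mul (hasDerivAt_one_sub_rpow hp x)).add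
    ((hsub x).mul (hasDerivAt_one_add_rpow hp x))
  have hd2 (x : ℝ) := (((hasDerivAt_one_sub_rpow hp x).const_mul 1).add
    ((hadd x).mul ((hasDerivAt_one_sub_rpow hp' x).const_mul p).neg)).add
    (((hasDerivAt_one_add_rpow hp x).const_mul (-1)).add
    ((hsub x).mul ((hasDerivAt_one_add_rpow hp' x).const_mul p)))
  refine concaveOn_of_hasDerivWithinAt2_nonpos (convex_Icc _ _)
    (fun x _ => (hd1 x).continuousAt.continuousWithinAt)
    (fun x _ => (hd1 x).hasDerivWithinAt) (fun x _ => (hd2 x).hasDerivWithinAt) fun x hx => ?_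
  rw [interior_Icc] at hx
  have ha : 0 < 1 - x := by linarith [hx.2]
  have hb : 0 < 1 + x := by linarith [hx.1]
  have hpow {a : ℝ} (ha : 0 < a) : a ^ (p - 1) = a * a ^ (p - 1 - 1) := by
    rw [Real.rpow_sub_one ha.ne' (p - 1)]
    field_simp
  have hcheb := mul_rpow_add_mul_rpow_le ha.le hb.le (q := p - 1 - 1) (by linarith)
  rw [Pi.neg_apply, hpow ha, hpow hb]
  have hA : 0 < (1 - x) ^ (p - 1 - 1) := Real.rpow_pos_of_pos ha _
  have hB : 0 < (1 + x) ^ (p - 1 - 1) := Real.rpow_pos_of_pos hb _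
  generalize (1 - x) ^ (p - 1 - 1) = A at *
  generalize (1 + x) ^ (p - 1 - 1) = B at *
  have hsum : 0 ≤ (1 - x) * A + (1 + x) * B := by positivity
  have h1 : 0 ≤ p * (p - 1) * ((1 - x) * A + (1 + x) * B - ((1 + x) * A + (1 - x) * B)) :=
    mul_nonneg (by nlinarith) (by linarith)
  have h2 : 0 ≤ p * (3 - p) * ((1 - x) * A + (1 + x) * B) :=
    mul_nonneg (by nlinarith) hsum
  linarith
end

section
/- For every real p > 3, the function g(x) = (1 + x)(1 − x)^p + (1 − x)(1 + x)^p has a strict local minimum at x = 0: there exists δ > 0 such that g(x) > g(0) = 2 for all x with 0 < |x| ≤ δ. -/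
/-- Bernoulli's inequality applied to `(1 + x) ^ 2` with exponent `q / 2`. -/
theorem one_add_mul_add_le_rpow {q x : ℝ} (hq : 2 ≤ q) (hx : -1 ≤ x) :
    1 + q * x + q / 2 * x ^ 2 ≤ (1 + x) ^ q := by
  have h0 : 0 ≤ 1 + x := by linarith
  have h := one_add_mul_self_le_rpow_one_add (s := 2 * x + x ^ 2) (p := q / 2)
    (by nlinarith [sq_nonneg (1 + x)]) (by linarith)
  rw [show 1 + (2 * x + x ^ 2) = (1 + x) ^ (2 : ℝ) by rw [Real.rpow_two]; ring,
    ← Real.rpow_mul h0, mul_div_cancel₀ q two_ne_zero] at h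
  linarith

theorem stmt12 (p : ℝ) (hp : 3 < p) :
    (1 + (0 : ℝ)) * (1 - (0 : ℝ)) ^ p + (1 - (0 : ℝ)) * (1 + (0 : ℝ)) ^ p = 2 ∧
    ∃ δ > (0 : ℝ), ∀ x : ℝ, x ≠ 0 → |x| ≤ δ →
      2 < (1 + x) * (1 - x) ^ p + (1 - x) * (1 + x) ^ p := by
  refine ⟨by norm_num, (p - 3) / (p - 1), div_pos (by linarith) (by linarith),
    fun x hx0 hx => ?_⟩
  have hp1 : 0 < p - 1 := by linarith
  have hδ : (p - 3) / (p - 1) < 1 := by rw [div_lt_one hp1]; linarith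
  have habs : |x| < 1 := hx.trans_lt hδ
  obtain ⟨hx1, hx2⟩ := abs_lt.mp habs
  have hsq : x ^ 2 < |x| := by
    rw [← sq_abs]
    nlinarith [abs_pos.mpr hx0]
  have hxp : x ^ 2 * (p - 1) < p - 3 := by
    rw [← lt_div_iff₀ hp1]
    exact hsq.trans_le hx
  have hx_sq : 0 < x ^ 2 := by positivity
  have hplus := one_add_mul_add_le_rpow (q := p - 1) (x := x) (by linarith) (by linarith)
  have hminus := one_add_mul_add_le_rpow (q := p - 1) (x := -x) (by linarith) (by linarith)
  rw [← sub_eq_add_neg] at hminus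
  have hfactor : (1 + x) * (1 - x) ^ p + (1 - x) * (1 + x) ^ p =
      (1 - x ^ 2) * ((1 - x) ^ (p - 1) + (1 + x) ^ (p - 1)) := by
    rw [Real.rpow_sub_one (by linarith), Real.rpow_sub_one (by linarith)]
    have h1 : 1 - x ≠ 0 := by linarith
    have h2 : 1 + x ≠ 0 := by linarith
    field_simp
    ring
  rw [hfactor]
  calc (2 : ℝ) < (1 - x ^ 2) * (2 + (p - 1) * x ^ 2) := by
        nlinarith [mul_pos hx_sq (sub_pos.mpr hxp)]
    _ ≤ _ := mul_le_mul_of_nonneg_left (by linarith) (by nlinarith)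
end

section
/- For every real p > 3, there exist ε > 0 and N such that for all n ≥ N, φ(2,p,n) > (1 + ε) · f(p, T_2(n)). -/
open Finset

/-- The complete bipartite graph whose two classes are the fibres of `c`. -/
def twoClassGraph {V : Type*} (c : V → Bool) : SimpleGraph V :=
  (⊤ : SimpleGraph Bool).comap c

theorem twoClassGraph_cliqueFree {V : Type*} (c : V → Bool) :
    (twoClassGraph c).CliqueFree 3 := by
  have h : (twoClassGraph c).Colorable (Fintype.card Bool) :=
    SimpleGraph.Coloring.colorable ⟨c, fun {_ _} hab => hab⟩
  exact h.cliqueFree (by simp)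

theorem degPowerSum_twoClassGraph (p : ℝ) {V : Type*} [Fintype V] (c : V → Bool) (a b : ℕ)
    (ha : #{v | c v = true} = a) (hb : #{v | c v = false} = b) :
    degPowerSum p (twoClassGraph c) = a * (b : ℝ) ^ p + b * (a : ℝ) ^ p := by
  classical
  let := Classical.decRel (twoClassGraph c).Adj
  have hdeg : ∀ v, (twoClassGraph c).degree v = if c v = true then b else a := by
    intro v
    rw [← SimpleGraph.card_neighborFinset_eq_degree, SimpleGraph.neighborFinset_eq_filter]
    cases hv : c v <;> simp [twoClassGraph, hv, ← ha, ← hb]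
  have hsum : degPowerSum p (twoClassGraph c)
      = ∑ v, if c v = true then (b : ℝ) ^ p else (a : ℝ) ^ p := by
    unfold degPowerSum
    refine Finset.sum_congr rfl fun v _ => ?_
    rw [hdeg v]
    split_ifs <;> rfl
  rw [hsum, Finset.sum_ite]
  simp [ha, hb]

theorem degPowerSum_le_phiClique (r : ℕ) (p : ℝ) {n : ℕ} (G : SimpleGraph (Fin n))
    (hG : G.CliqueFree (r + 1)) : degPowerSum p G ≤ phiClique r p n := by
  refine le_csSup (Set.Finite.bddAbove ?_) ⟨G, hG, rfl⟩
  refine (Set.finite_range fun G : SimpleGraph (Fin n) => degPowerSum p G).subset ?_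
  rintro _ ⟨H, -, rfl⟩
  exact ⟨H, rfl⟩

theorem card_filter_odd_fin (n : ℕ) :
    #{v : Fin n | decide ((v : ℕ) % 2 = 1) = true} = n / 2 := by
  have h : ∀ m, #{k ∈ range m | k % 2 = 1} = m / 2 := by
    intro m
    induction m with
    | zero => simp
    | succ m ih =>
      rw [range_add_one, filter_insert]
      split_ifs
      · rw [card_insert_of_notMem (by simp), ih]; omega
      · rw [ih]; omega
  rw [← h n, card_filter, card_filter, ← Fin.sum_univ_eq_sum_range]
  simp

theorem card_filter_false_fin {n a : ℕ} (c : Fin n → Bool) (h : #{v | c v = true} = a) :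
    #{v | c v = false} = n - a := by
  have := card_filter_add_card_filter_not (s := (univ : Finset (Fin n))) (fun v => c v = true)
  simp only [Bool.not_eq_true, card_univ, Fintype.card_fin] at this
  omega

/-- The limit of `f(p, K_{a,n-a}) / n^(p+1)` as `a / n → x`. -/
noncomputable def bipartiteDensity (p x : ℝ) : ℝ :=
  x * (1 - x) ^ p + (1 - x) * x ^ p

theorem continuous_bipartiteDensity {p : ℝ} (hp : 0 ≤ p) : Continuous (bipartiteDensity p) := by
  unfold bipartiteDensity
  have h1 := Real.continuous_rpow_const hp
  exact (continuous_id.mul (h1.comp (continuous_const.sub continuous_id))).add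
    ((continuous_const.sub continuous_id).mul h1)

theorem degPowerSum_twoClassGraph_fin (p : ℝ) {n a : ℕ} (hn : 0 < n) (han : a ≤ n)
    (c : Fin n → Bool) (h : #{v | c v = true} = a) :
    degPowerSum p (twoClassGraph c) = (n : ℝ) * (n : ℝ) ^ p * bipartiteDensity p (a / n) := by
  rw [degPowerSum_twoClassGraph p c a (n - a) h (card_filter_false_fin c h), bipartiteDensity]
  have hn' : (0 : ℝ) < n := by exact_mod_cast hn
  have han' : (a : ℝ) ≤ n := by exact_mod_cast han
  have hb : (1 : ℝ) - a / n = ((n : ℝ) - a) / n := by field_simp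
  rw [hb, Real.div_rpow (by linarith) hn'.le, Real.div_rpow (by positivity) hn'.le,
    Nat.cast_sub han]
  have := (Real.rpow_pos_of_pos hn' p).ne'
  field_simp

theorem turanGraph_two_eq (n : ℕ) :
    SimpleGraph.turanGraph n 2 = twoClassGraph fun v : Fin n => decide ((v : ℕ) % 2 = 1) := by
  ext v w
  simp only [SimpleGraph.turanGraph, twoClassGraph, SimpleGraph.comap_adj, SimpleGraph.top_adj,
    ne_eq, decide_eq_decide]
  omega

theorem exists_bipartiteDensity_gt {p : ℝ} (hp : 3 < p) :
    ∃ x, 0 < x ∧ x < 1 ∧ bipartiteDensity p (1 / 2) < bipartiteDensity p x := by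
  obtain ⟨s, hs⟩ : ∃ s, s = (p - 1) / 2 := ⟨_, rfl⟩
  have hs1 : 1 < s := by linarith
  obtain ⟨t, ht⟩ : ∃ t, t = (s - 1) / s := ⟨_, rfl⟩
  have hts : t * s = s - 1 := by rw [ht]; field_simp
  have ht0 : 0 < t := by rw [ht]; exact div_pos (by linarith) (by linarith)
  have ht1 : t < 1 := by rw [ht, div_lt_one (by linarith)]; linarith
  refine ⟨(1 - t) / 2, by linarith, by linarith, ?_⟩
  have hsq : ∀ y : ℝ, -1 < y → 1 + s * (2 * y + y ^ 2) ≤ (1 + y) ^ (p - 1) := by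
    intro y hy
    have h := one_add_mul_self_le_rpow_one_add (s := 2 * y + y ^ 2)
      (by nlinarith [sq_nonneg (1 + y)]) hs1.le
    have h2 : (1 + y) ^ (p - 1) = (1 + (2 * y + y ^ 2)) ^ s := by
      rw [show p - 1 = 2 * s by linarith, Real.rpow_mul (by linarith), Real.rpow_two]
      congr 1
      ring
    rw [h2]
    exact h
  have hsplit : ∀ y : ℝ, 0 < y → y ^ p = y * y ^ (p - 1) := by
    intro y hy
    rw [← Real.rpow_one_add' hy.le (by linarith)]
    congr 1
    ring
  have h1 := hsq t (by linarith)
  have h2 := hsq (-t) (by linarith)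
  rw [← sub_eq_add_neg] at h2
  have h2p : (0 : ℝ) < 2 ^ p := by positivity
  have e1 : bipartiteDensity p (1 / 2) = 1 / 2 ^ p := by
    rw [bipartiteDensity, show (1 : ℝ) - 1 / 2 = 1 / 2 by norm_num,
      Real.div_rpow (by norm_num) (by norm_num), Real.one_rpow]
    ring
  have e2 : bipartiteDensity p ((1 - t) / 2)
      = ((1 - t ^ 2) / 2 * ((1 + t) ^ (p - 1) + (1 - t) ^ (p - 1))) / 2 ^ p := by
    rw [bipartiteDensity, show 1 - (1 - t) / 2 = (1 + t) / 2 by ring,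
      Real.div_rpow (by linarith) (by norm_num), Real.div_rpow (by linarith) (by norm_num),
      hsplit _ (by linarith : 0 < 1 + t), hsplit _ (by linarith : 0 < 1 - t)]
    ring
  rw [e1, e2, div_lt_div_iff_of_pos_right h2p]
  have h3 : 2 + 2 * s * t ^ 2 ≤ (1 + t) ^ (p - 1) + (1 - t) ^ (p - 1) := by linarith
  have h4 : (1 - t ^ 2) / 2 * (2 + 2 * s * t ^ 2)
      ≤ (1 - t ^ 2) / 2 * ((1 + t) ^ (p - 1) + (1 - t) ^ (p - 1)) :=
    mul_le_mul_of_nonneg_left h3 (by nlinarith)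
  refine lt_of_lt_of_le ?_ h4
  have h5 : (1 - t ^ 2) / 2 * (2 + 2 * s * t ^ 2) = 1 + t ^ 2 * ((s - 1) * (1 - t)) := by
    linear_combination (-t ^ 3) * hts
  rw [h5]
  have : 0 < t ^ 2 * ((s - 1) * (1 - t)) :=
    mul_pos (by positivity) (mul_pos (by linarith) (by linarith))
  linarith

theorem stmt13 (p : ℝ) (hp : 3 < p) :
    ∃ ε > (0 : ℝ), ∃ N : ℕ, ∀ n : ℕ, N ≤ n →
      (1 + ε) * degPowerSum p (SimpleGraph.turanGraph n 2) < phiClique 2 p n := by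
  obtain ⟨x, hx0, hx1, hx⟩ := exists_bipartiteDensity_gt hp
  have hcont := continuous_bipartiteDensity (p := p) (by linarith)
  have hlim : ∀ y : ℝ, 0 ≤ y → Filter.Tendsto
      (fun n : ℕ => bipartiteDensity p ((⌊y * n⌋₊ : ℝ) / n)) Filter.atTop
      (nhds (bipartiteDensity p y)) := fun y hy =>
    (hcont.tendsto y).comp
      ((tendsto_nat_floor_mul_div_atTop hy).comp tendsto_natCast_atTop_atTop)
  obtain ⟨ε, hε, hεx⟩ : ∃ ε > (0 : ℝ),
      (1 + ε) * bipartiteDensity p (1 / 2) < bipartiteDensity p x := by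
    have hpos : 0 < bipartiteDensity p (1 / 2) := by
      unfold bipartiteDensity
      norm_num
      positivity
    refine ⟨(bipartiteDensity p x / bipartiteDensity p (1 / 2) - 1) / 2, ?_, ?_⟩
    · have := (one_lt_div hpos).2 hx
      linarith
    · field_simp
      linarith
  have hev := ((hlim (1 / 2) (by norm_num)).const_mul (1 + ε)).eventually_lt (hlim x hx0.le) hεx
  obtain ⟨N, hN⟩ := Filter.eventually_atTop.1 (hev.and (Filter.eventually_gt_atTop 0))
  refine ⟨ε, hε, N, fun n hn => ?_⟩
  obtain ⟨hlt, hn0⟩ := hN n hn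
  have hn' : (0 : ℝ) < n := by exact_mod_cast hn0
  have hfl : ⌊(1 / 2 : ℝ) * n⌋₊ = n / 2 := by
    rw [show (1 / 2 : ℝ) * n = n / 2 by ring, Nat.floor_div_ofNat, Nat.floor_natCast]
  rw [hfl] at hlt
  have hxn : ⌊x * n⌋₊ ≤ n := Nat.floor_le_of_le (by nlinarith)
  have hcard : #{v : Fin n | decide ((v : ℕ) < ⌊x * n⌋₊) = true} = ⌊x * n⌋₊ := by
    simp [Fin.card_filter_val_lt, hxn]
  refine lt_of_lt_of_le ?_ (degPowerSum_le_phiClique 2 p _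
    (twoClassGraph_cliqueFree fun v : Fin n => decide ((v : ℕ) < ⌊x * n⌋₊)))
  rw [turanGraph_two_eq, degPowerSum_twoClassGraph_fin p hn0 (Nat.div_le_self n 2) _
    (card_filter_odd_fin n), degPowerSum_twoClassGraph_fin p hn0 hxn _ hcard]
  have hc : (0 : ℝ) < n * (n : ℝ) ^ p := mul_pos hn' (Real.rpow_pos_of_pos hn' p)
  have := mul_lt_mul_of_pos_left hlt hc
  linarith
end

section
/- Let r ≥ 2 be an integer, let H be a finite simple graph with chromatic number r + 1, and let p > 0 be real. Then for every n ≥ 1, φ(H,p,n) ≥ φ(r,p,n). -/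
open Finset

/-- `G` contains a subgraph isomorphic to `H`. -/
def Contains {α β : Type*} (G : SimpleGraph α) (H : SimpleGraph β) : Prop :=
  ∃ f : H →g G, Function.Injective f

/-- `φ(H,p,n)`: the maximum of `f(p,G)` over `H`-free graphs on `n` vertices. -/
noncomputable def phiForb {W : Type*} [Fintype W] (H : SimpleGraph W) (p : ℝ) (n : ℕ) : ℝ :=
  sSup {x | ∃ G : SimpleGraph (Fin n), ¬ Contains G H ∧ x = degPowerSum p G}

open Classical in
/-- The degree majorization theorem of Erdős: the degrees inside a `K_{r+1}`-free vertex set `S` are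
dominated by
those of a complete `r`-partite graph on `S`, given here by the colouring `c`. -/
theorem SimpleGraph.exists_coloring_card_filter_adj_le {V : Type*} (G : SimpleGraph V) (r : ℕ)
    (S : Finset V) (hS : ∀ t ⊆ S, ¬ G.IsNClique (r + 1) t) :
    ∃ c : V → ℕ, (∀ v ∈ S, c v < r) ∧
      ∀ v ∈ S, #{w ∈ S | G.Adj v w} ≤ #{w ∈ S | c v ≠ c w} := by
  induction r generalizing S with
  | zero =>
    have hempty : ∀ v ∉ (∅ : Finset V), v ∉ S := fun v _ hv =>
      hS {v} (by simpa using hv) (by simp [SimpleGraph.isNClique_iff])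
    exact ⟨0, fun v hv => absurd hv (hempty v (by simp)),
      fun v hv => absurd hv (hempty v (by simp))⟩
  | succ r ih =>
    obtain rfl | hne := S.eq_empty_or_nonempty
    · exact ⟨0, by simp, by simp⟩
    obtain ⟨x, hx, hmax⟩ := S.exists_max_image (fun v => #{w ∈ S | G.Adj v w}) hne
    set T : Finset V := {w ∈ S | G.Adj x w} with hT
    have hTS : T ⊆ S := filter_subset _ _
    obtain ⟨c, hc, hdeg⟩ := ih T fun t ht hcl =>
      hS (insert x t) (insert_subset hx (ht.trans hTS))
        (hcl.insert fun b hb => (mem_filter.1 (ht hb)).2)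
    refine ⟨fun v => if v ∈ T then c v else r, fun v _ => ?_, fun v hv => ?_⟩
    · dsimp only
      split_ifs with h
      · exact (hc v h).trans (Nat.lt_succ_self r)
      · exact Nat.lt_succ_self r
    by_cases hvT : v ∈ T
    · have hsplit : ∀ (P : V → Prop) [DecidablePred P],
          #{w ∈ S | P w} = #{w ∈ T | P w} + #{w ∈ S \ T | P w} := by
        intro P _
        rw [← card_union_of_disjoint (disjoint_filter_filter disjoint_sdiff), ← filter_union,
          union_sdiff_of_subset hTS]
      rw [hsplit, hsplit]
      refine add_le_add ((hdeg v hvT).trans (card_le_card fun w hw => ?_))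
        (card_le_card fun w hw => ?_)
      · have hw' := mem_filter.1 hw
        simpa [hvT, hw'.1] using hw'.2
      · have hw' := mem_sdiff.1 (mem_filter.1 hw).1
        refine mem_filter.2 ⟨(mem_filter.1 hw).1, ?_⟩
        simpa [hvT, hw'.2] using (hc v hvT).ne
    · refine (hmax v hv).trans (card_le_card fun w hw => mem_filter.2 ⟨hTS hw, ?_⟩)
      simpa [hvT, show w ∈ T from hw] using (hc w hw).ne.symm

/-- Every finite `K_{r+1}`-free graph is dominated in degree power sum by an `r`-colourable one. -/
theorem SimpleGraph.CliqueFree.exists_colorable_degPowerSum_le {V : Type*} [Fintype V]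
    {G : SimpleGraph V} {r : ℕ} (hG : G.CliqueFree (r + 1)) {p : ℝ} (hp : 0 ≤ p) :
    ∃ G' : SimpleGraph V, G'.Colorable r ∧ degPowerSum p G ≤ degPowerSum p G' := by
  classical
  obtain ⟨c, hc, hdeg⟩ := G.exists_coloring_card_filter_adj_le r univ fun t _ => hG t
  refine ⟨(⊤ : SimpleGraph ℕ).comap c,
    ⟨SimpleGraph.Coloring.mk (fun v => (⟨c v, hc v (mem_univ v)⟩ : Fin r)) ?_⟩, ?_⟩
  · intro v w hvw h
    exact hvw (congrArg Fin.val h)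
  · refine sum_le_sum fun v _ => Real.rpow_le_rpow (Nat.cast_nonneg _) (Nat.cast_le.2 ?_) hp
    rw [← SimpleGraph.card_neighborFinset_eq_degree, ← SimpleGraph.card_neighborFinset_eq_degree,
      SimpleGraph.neighborFinset_eq_filter, SimpleGraph.neighborFinset_eq_filter]
    convert hdeg v (mem_univ v)

theorem stmt15 (r : ℕ) (hr : 2 ≤ r) {W : Type*} [Fintype W] (H : SimpleGraph W)
    (hchrom : H.chromaticNumber = (r + 1 : ℕ)) (p : ℝ) (hp : 0 < p)
    (n : ℕ) (hn : 1 ≤ n) :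
    phiClique r p n ≤ phiForb H p n := by
  have hbdd : BddAbove
      {x | ∃ G : SimpleGraph (Fin n), ¬ Contains G H ∧ x = degPowerSum p G} := by
    refine (Set.finite_range (degPowerSum p (V := Fin n))).bddAbove.mono ?_
    rintro _ ⟨G, _, rfl⟩
    exact ⟨G, rfl⟩
  refine csSup_le ⟨degPowerSum p ⊥, ⊥, SimpleGraph.cliqueFree_bot (by omega), rfl⟩ ?_
  rintro _ ⟨G, hG, rfl⟩
  obtain ⟨G', hcol, hle⟩ := hG.exists_colorable_degPowerSum_le hp.le
  refine hle.trans (le_csSup hbdd ⟨G', ?_, rfl⟩)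
  rintro ⟨f, -⟩
  have hH : H.chromaticNumber ≤ r := (hcol.of_hom f).chromaticNumber_le
  rw [hchrom, Nat.cast_le] at hH
  omega
end
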